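/- arXiv:1907.02922 — 7 statements merged into one kernel-verified Lean document; each statement's English description precedes it below -/
import Mathlib

section
/- Let k be an algebraically closed field, K a finite group, and K₂ a normal subgroup of K whose order is not divisible by the characteristic of k. Let V₁ and V₂ be nonzero finite-dimensional k-vector spaces with representations ρ₁, ρ₂ of K such that ρ₂(x) = id for all x ∈ K₂, and assume that every k-linear endomorphism of V₁ commuting with ρ₁(x) for all x ∈ K₂ also commutes with ρ₁(g) for all g ∈ K. Then the diagonal representation of K on V₁ ⊗_k V₂ is irreducible if and only if both ρ₁ and ρ₂ are irreducible. -/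
open TensorProduct

/-- A representation is irreducible if the space is nonzero and the only
subspaces stable under the group action are `⊥` and `⊤`. -/
def IsIrreducibleRep {k G V : Type*} [Field k] [Group G] [AddCommGroup V] [Module k V]
    (ρ : Representation k G V) : Prop :=
  Nontrivial V ∧
    ∀ W : Submodule k V, (∀ g : G, ∀ v ∈ W, ρ g v ∈ W) → W = ⊥ ∨ W = ⊤

open Module
open scoped MonoidAlgebra

/-- **Burnside's theorem** for representations: over an algebraically closed field, the image of the
group algebra under an irreducible finite-dimensional representation is the full endomorphism
algebra. -/
theorem Representation.IsIrreducible.asAlgebraHom_surjective {k G V : Type*} [Field k]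
    [IsAlgClosed k] [Group G] [AddCommGroup V] [Module k V] [FiniteDimensional k V]
    (ρ : Representation k G V) [ρ.IsIrreducible] :
    Function.Surjective ρ.asAlgebraHom := by
  have hbij : Function.Bijective (algebraMap k (End k[G] ρ.asModule)) :=
    IsSimpleModule.algebraMap_end_bijective_of_isAlgClosed k
  have : Module.Finite (End k[G] ρ.asModule) ρ.asModule :=
    Module.Finite.of_restrictScalars_finite k _ _
  intro f
  let F : End (End k[G] ρ.asModule) ρ.asModule :=
    { toFun := fun v ↦ ρ.asModuleEquiv.symm (f (ρ.asModuleEquiv v))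
      map_add' := by simp
      map_smul' := fun φ v ↦ by
        obtain ⟨c, rfl⟩ := hbij.2 φ
        simp }
  obtain ⟨r, hr⟩ := Module.Finite.toModuleEnd_moduleEnd_surjective (R := k[G])
    (M := ρ.asModule) F
  refine ⟨r, LinearMap.ext fun v ↦ ?_⟩
  have h := congrArg ρ.asModuleEquiv (LinearMap.congr_fun hr (ρ.asModuleEquiv.symm v))
  simpa [F, Representation.asModuleEquiv_map_smul] using h

/-- If a subrepresentation has an invariant complement, then it is the range of an endomorphism
commuting with the group action. -/
theorem Subrepresentation.exists_intertwiningMap_range_eq {k G V : Type*} [Field k] [Group G]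
    [AddCommGroup V] [Module k V] {ρ : Representation k G V} {S T : Subrepresentation ρ}
    (h : IsCompl S T) :
    ∃ f : V →ₗ[k] V, (∀ g, f ∘ₗ ρ g = ρ g ∘ₗ f) ∧ LinearMap.range f = S.toSubmodule := by
  have hc : IsCompl S.toSubmodule T.toSubmodule := by
    rw [isCompl_iff, disjoint_iff, codisjoint_iff] at h ⊢
    exact ⟨congrArg Subrepresentation.toSubmodule h.1,
      congrArg Subrepresentation.toSubmodule h.2⟩
  refine ⟨S.toSubmodule.projection T.toSubmodule hc, fun g ↦ LinearMap.ext fun v ↦ ?_,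
    Submodule.range_projection hc⟩
  obtain ⟨s, hs, t, ht, rfl⟩ := Submodule.mem_sup.1 (hc.sup_eq_top ▸ Submodule.mem_top (x := v))
  have hs' := S.apply_mem_toSubmodule g hs
  have ht' := T.apply_mem_toSubmodule g ht
  simp [Submodule.projection_apply_of_mem_left hc hs,
    Submodule.projection_apply_of_mem_left hc hs',
    (Submodule.projection_apply_eq_zero_iff hc).2 ht,
    (Submodule.projection_apply_eq_zero_iff hc).2 ht']

/-- If a finite group `H` of order invertible in `k` maps to `G`, and every endomorphism commuting
with `H` commutes with `G`, then irreducible representations of `G` stay irreducible on `H`. -/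
theorem IsIrreducibleRep.isIrreducible_comp {k G H V : Type*} [Field k] [Group G] [Group H]
    [Finite H] [NeZero (Nat.card H : k)] [AddCommGroup V] [Module k V]
    {ρ : Representation k G V} (hρ : IsIrreducibleRep ρ) (φ : H →* G)
    (hcent : ∀ f : V →ₗ[k] V, (∀ x, f ∘ₗ ρ (φ x) = ρ (φ x) ∘ₗ f) →
      ∀ g, f ∘ₗ ρ g = ρ g ∘ₗ f) :
    Representation.IsIrreducible (MonoidHom.comp ρ φ : Representation k H V) := by
  have := hρ.1
  have : Representation.IsSemisimpleRepresentation (MonoidHom.comp ρ φ : Representation k H V) :=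
    (Representation.isSemisimpleRepresentation_iff_isSemisimpleModule_asModule _).2 inferInstance
  refine
    { exists_pair_ne := ⟨⊥, ⊤, fun h ↦
        bot_ne_top (α := Submodule k V) (congrArg Subrepresentation.toSubmodule h)⟩
      eq_bot_or_eq_top := fun S ↦ ?_ }
  obtain ⟨T, hT⟩ := exists_isCompl S
  obtain ⟨f, hf, hfS⟩ := Subrepresentation.exists_intertwiningMap_range_eq hT
  refine (hρ.2 S.toSubmodule fun g v hv ↦ ?_).imp
    (fun h ↦ Subrepresentation.toSubmodule_injective h)
    (fun h ↦ Subrepresentation.toSubmodule_injective h)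
  rw [← hfS] at hv ⊢
  obtain ⟨w, rfl⟩ := hv
  exact ⟨ρ g w, LinearMap.congr_fun (hcent f hf g) w⟩

/-- Irreducibility is invariant under isomorphism of representations. -/
theorem IsIrreducibleRep.congr {k G V W : Type*} [Field k] [Group G] [AddCommGroup V] [Module k V]
    [AddCommGroup W] [Module k W] {ρ : Representation k G V} {σ : Representation k G W}
    (hρ : IsIrreducibleRep ρ) (e : V ≃ₗ[k] W) (he : ∀ g v, e (ρ g v) = σ g (e v)) :
    IsIrreducibleRep σ := by
  have := hρ.1
  refine ⟨e.symm.toEquiv.nontrivial, fun U hU ↦ ?_⟩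
  have hcomap : (U.comap (e : V →ₗ[k] W)).map (e : V →ₗ[k] W) = U :=
    Submodule.map_comap_eq_of_surjective e.surjective U
  refine (hρ.2 (U.comap (e : V →ₗ[k] W)) fun g v hv ↦ ?_).imp (fun h ↦ ?_) fun h ↦ ?_
  · simpa [he] using hU g _ hv
  · rw [← hcomap, h, Submodule.map_bot]
  · rw [← hcomap, h, Submodule.map_top, LinearEquiv.range]

theorem TensorProduct.eq_zero_of_tmul_eq_zero {k V W : Type*} [Field k] [AddCommGroup V]
    [Module k V] [AddCommGroup W] [Module k W] {v : V} {w : W} (hw : w ≠ 0)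
    (h : v ⊗ₜ[k] w = 0) : v = 0 := by
  obtain ⟨ψ, hψ⟩ := not_forall.1 fun hall ↦ hw ((Module.forall_dual_apply_eq_zero_iff k w).1 hall)
  simpa [hψ] using congrArg (fun t ↦ TensorProduct.rid k V (ψ.lTensor V t)) h

section Tensor

variable {k G V₁ V₂ : Type*} [Field k] [Group G] [AddCommGroup V₁] [Module k V₁]
  [AddCommGroup V₂] [Module k V₂] {ρ₁ : Representation k G V₁} {ρ₂ : Representation k G V₂}

theorem IsIrreducibleRep.of_tprod_left [Nontrivial V₁] [Nontrivial V₂]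
    (h : IsIrreducibleRep (ρ₁.tprod ρ₂)) : IsIrreducibleRep ρ₁ := by
  refine ⟨inferInstance, fun W hW ↦ ?_⟩
  obtain ⟨u, hu⟩ := exists_ne (0 : V₂)
  have key := h.2 (LinearMap.range (W.subtype.rTensor V₂)) (by
    rintro g _ ⟨t, rfl⟩
    refine ⟨TensorProduct.map ((ρ₁ g).restrict (hW g)) (ρ₂ g) t, ?_⟩
    induction t with
    | zero => simp
    | tmul x y => simp
    | add x y hx hy => simp only [map_add, hx, hy])
  refine key.imp (fun hbot ↦ (Submodule.eq_bot_iff _).2 fun w hw ↦ ?_) fun htop ↦ ?_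
  · have : w ⊗ₜ[k] u ∈ LinearMap.range (W.subtype.rTensor V₂) := ⟨⟨w, hw⟩ ⊗ₜ u, by simp⟩
    rw [hbot, Submodule.mem_bot] at this
    exact TensorProduct.eq_zero_of_tmul_eq_zero hu this
  · refine Submodule.eq_top_iff'.2 fun v ↦ by_contra fun hv ↦ ?_
    obtain ⟨t, ht⟩ : v ⊗ₜ[k] u ∈ LinearMap.range (W.subtype.rTensor V₂) := htop ▸ trivial
    have hzero := congrArg (W.mkQ.rTensor V₂) ht
    rw [← LinearMap.comp_apply, ← LinearMap.rTensor_comp] at hzero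
    have : W.mkQ ∘ₗ W.subtype = 0 := by ext; simp
    rw [this, LinearMap.rTensor_zero, LinearMap.zero_apply, LinearMap.rTensor_tmul] at hzero
    exact hv ((Submodule.Quotient.mk_eq_zero W).1
      (TensorProduct.eq_zero_of_tmul_eq_zero hu hzero.symm))

theorem IsIrreducibleRep.of_tprod_right [Nontrivial V₁] [Nontrivial V₂]
    (h : IsIrreducibleRep (ρ₁.tprod ρ₂)) : IsIrreducibleRep ρ₂ :=
  (h.congr (TensorProduct.comm k V₁ V₂) fun g t ↦ by
    induction t with
    | zero => simp
    | tmul x y => simp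
    | add x y hx hy => simp only [map_add, hx, hy] : IsIrreducibleRep (ρ₂.tprod ρ₁)).of_tprod_left

/-- If `W` is a nonzero submodule of `V₁ ⊗ V₂` stable under `End V₁`, then it contains
`V₁ ⊗ u` for some nonzero `u`. -/
theorem TensorProduct.exists_forall_tmul_mem {W : Submodule k (V₁ ⊗[k] V₂)} (hW : W ≠ ⊥)
    (hstable : ∀ f : V₁ →ₗ[k] V₁, ∀ w ∈ W, f.rTensor V₂ w ∈ W) :
    ∃ u : V₂, u ≠ 0 ∧ ∀ v : V₁, v ⊗ₜ[k] u ∈ W := by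
  classical
  obtain ⟨w, hw, hw0⟩ := W.ne_bot_iff.1 hW
  let b := Basis.ofVectorSpace k V₁
  obtain ⟨i, hi⟩ : ∃ i, TensorProduct.equivFinsuppOfBasisLeft b w i ≠ 0 := by
    by_contra! hall
    exact hw0 ((LinearEquiv.map_eq_zero_iff _).1 (Finsupp.ext hall))
  refine ⟨_, hi, fun v ↦ ?_⟩
  convert hstable ((b.coord i).smulRight v) w hw
  rw [TensorProduct.equivFinsuppOfBasisLeft_apply]
  clear hw hw0 hi
  induction w with
  | zero => simp
  | tmul x y => simp [TensorProduct.smul_tmul]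
  | add x y hx hy => simp only [map_add, TensorProduct.tmul_add, hx, hy]

theorem IsIrreducibleRep.tprod [Nontrivial V₁] (h₂ : IsIrreducibleRep ρ₂)
    (hstable : ∀ W : Submodule k (V₁ ⊗[k] V₂), (∀ g, ∀ w ∈ W, ρ₁.tprod ρ₂ g w ∈ W) →
      ∀ f : V₁ →ₗ[k] V₁, ∀ w ∈ W, f.rTensor V₂ w ∈ W) :
    IsIrreducibleRep (ρ₁.tprod ρ₂) := by
  have := h₂.1
  refine ⟨inferInstance, fun W hW ↦ or_iff_not_imp_left.2 fun hbot ↦ ?_⟩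
  obtain ⟨u, hu, huW⟩ := TensorProduct.exists_forall_tmul_mem hbot (hstable W hW)
  let U : Submodule k V₂ := ⨅ v : V₁, W.comap (TensorProduct.mk k V₁ V₂ v)
  have hU : ∀ y, y ∈ U ↔ ∀ v, v ⊗ₜ[k] y ∈ W := fun y ↦ by simp [U]
  have hUtop : U = ⊤ := by
    refine (h₂.2 U fun g y hy ↦ (hU _).2 fun v ↦ ?_).resolve_left
      fun h ↦ hu ((Submodule.eq_bot_iff _).1 h u ((hU u).2 huW))
    simpa using hW g _ ((hU y).1 hy (ρ₁ g⁻¹ v))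
  refine Submodule.eq_top_iff'.2 fun t ↦ ?_
  induction t with
  | zero => exact W.zero_mem
  | tmul x y => exact (hU y).1 (hUtop ▸ trivial) x
  | add x y hx hy => exact W.add_mem hx hy

end Tensor

theorem stmt1 {k : Type*} [Field k] [IsAlgClosed k] {K : Type*} [Group K] [Finite K]
    {V₁ V₂ : Type*} [AddCommGroup V₁] [Module k V₁] [AddCommGroup V₂] [Module k V₂]
    [FiniteDimensional k V₁] [FiniteDimensional k V₂] [Nontrivial V₁] [Nontrivial V₂]
    (K₂ : Subgroup K) (hK₂ : K₂.Normal) (hord : ¬ (ringChar k ∣ Nat.card K₂))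
    (ρ₁ : Representation k K V₁) (ρ₂ : Representation k K V₂)
    (hρ₂triv : ∀ x ∈ K₂, ρ₂ x = LinearMap.id)
    (hcent : ∀ f : V₁ →ₗ[k] V₁, (∀ x ∈ K₂, f ∘ₗ ρ₁ x = ρ₁ x ∘ₗ f) →
      ∀ g : K, f ∘ₗ ρ₁ g = ρ₁ g ∘ₗ f) :
    IsIrreducibleRep (ρ₁.tprod ρ₂) ↔ IsIrreducibleRep ρ₁ ∧ IsIrreducibleRep ρ₂ := by
  refine ⟨fun h ↦ ⟨h.of_tprod_left, h.of_tprod_right⟩, fun ⟨h₁, h₂⟩ ↦ h₂.tprod fun W hW f ↦ ?_⟩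
  have : NeZero (Nat.card K₂ : k) := ⟨fun h ↦ hord ((ringChar.spec k _).1 h)⟩
  let σ : Representation k K₂ V₁ := MonoidHom.comp ρ₁ K₂.subtype
  have : σ.IsIrreducible := h₁.isIrreducible_comp K₂.subtype fun f hf ↦
    hcent f fun x hx ↦ hf ⟨x, hx⟩
  obtain ⟨r, rfl⟩ := Representation.IsIrreducible.asAlgebraHom_surjective σ f
  induction r using MonoidAlgebra.induction_on with
  | of x =>
    intro w hw
    have := hW x w hw
    rw [Representation.tprod_apply, hρ₂triv x x.2] at this
    simpa [σ, LinearMap.rTensor] using this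
  | add a b ha hb =>
    intro w hw
    simpa using W.add_mem (ha w hw) (hb w hw)
  | smul c a ha =>
    intro w hw
    simpa using W.smul_mem c (ha w hw)
end

section
/- Let k be an algebraically closed field, K a finite group, and K₂ a normal subgroup of K whose order is not divisible by the characteristic of k. Let ρ₁ be an irreducible representation of K on a nonzero finite-dimensional k-vector space V₁ such that every k-linear endomorphism of V₁ commuting with ρ₁(x) for all x ∈ K₂ is a scalar multiple of the identity. Let ρ be an irreducible representation of K on a finite-dimensional k-vector space W such that the restriction of ρ to K₂ is isomorphic to a finite direct sum of copies of the restriction of ρ₁ to K₂. Then there exists an irreducible representation ρ₂′ of K on a finite-dimensional k-vector space W₂ with ρ₂′(x) = id for all x ∈ K₂, such that ρ is isomorphic to the diagonal representation of K on V₁ ⊗_k W₂ given by g ↦ ρ₁(g) ⊗ ρ₂′(g). -/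
open TensorProduct

/-- A matrix acting on `n`-tuples of vectors of a nontrivial vector space is determined by its
action. -/
lemma Matrix.ext_of_sum_smul {k V m n : Type*} [Field k] [AddCommGroup V] [Module k V]
    [Nontrivial V] [Fintype n] {A B : Matrix m n k}
    (h : ∀ (v : n → V) (i : m), ∑ j, A i j • v j = ∑ j, B i j • v j) : A = B := by
  classical
  obtain ⟨u, hu⟩ := exists_ne (0 : V)
  ext i j
  have := h (Pi.single j u) i
  simp only [Pi.single_apply, smul_ite, smul_zero, Finset.sum_ite_eq', Finset.mem_univ, if_true]
    at this
  exact smul_left_injective k hu this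

/-- Let `ρ` be a representation on `W` whose restriction to the normal subgroup `N` is a direct sum
of copies of the restriction of `σ`. If the only endomorphisms commuting with `σ` on `N` are the
scalars, then each `ρ g` is given by a matrix of scalars times `σ g`. -/
lemma Representation.exists_matrix_of_isotypic {k G V W ι : Type*} [Field k] [Group G]
    [AddCommGroup V] [Module k V] [AddCommGroup W] [Module k W] [Fintype ι]
    {N : Subgroup G} (hN : N.Normal) {σ : Representation k G V} {ρ : Representation k G W}
    (hscalar : ∀ f : V →ₗ[k] V, (∀ x ∈ N, f ∘ₗ σ x = σ x ∘ₗ f) → ∃ c : k, f = c • LinearMap.id)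
    (e : W ≃ₗ[k] (ι → V)) (he : ∀ x ∈ N, ∀ w : W, e (ρ x w) = fun i => σ x (e w i)) (g : G) :
    ∃ A : Matrix ι ι k, ∀ w i, e (ρ g w) i = ∑ j, A i j • σ g (e w j) := by
  classical
  let f (i j : ι) : V →ₗ[k] V :=
    LinearMap.proj i ∘ₗ e.toLinearMap ∘ₗ ρ g ∘ₗ e.symm.toLinearMap ∘ₗ
      LinearMap.single k (fun _ => V) j
  have hf (i j : ι) : ∃ c : k, σ g⁻¹ ∘ₗ f i j = c • LinearMap.id := by
    refine hscalar _ fun x hx => LinearMap.ext fun v => ?_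
    have hsingle : e.symm (Pi.single j (σ x v)) = ρ x (e.symm (Pi.single j v)) := by
      rw [e.symm_apply_eq, he x hx, e.apply_symm_apply]
      ext l
      exact (Pi.apply_single (fun _ => σ x) (fun _ => map_zero _) j v l).symm
    have hconj : ρ g (ρ x (e.symm (Pi.single j v))) =
        ρ (g * x * g⁻¹) (ρ g (e.symm (Pi.single j v))) := by
      simp only [← Module.End.mul_apply, ← map_mul, inv_mul_cancel_right]
    simp only [f, LinearMap.comp_apply, LinearMap.coe_single, LinearEquiv.coe_coe,
      LinearMap.proj_apply, hsingle, hconj, he _ (hN.conj_mem x hx g)]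
    rw [← Module.End.mul_apply, ← Module.End.mul_apply, ← map_mul, ← map_mul, mul_assoc g x,
      inv_mul_cancel_left]
  choose A hA using hf
  refine ⟨A, fun w i => ?_⟩
  have hfA (j : ι) (v : V) : f i j v = A i j • σ g v := by
    have := congrArg (σ g) (LinearMap.congr_fun (hA i j) v)
    simpa using this
  have hw : w = ∑ j, e.symm (Pi.single j (e w j)) := by
    rw [← map_sum, Finset.univ_sum_single, e.symm_apply_apply]
  conv_lhs => rw [hw]
  simp only [map_sum, Finset.sum_apply, ← hfA]
  rfl

/-- If `ρ` is irreducible and is given in coordinates by a matrix representation times `σ`, then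
the matrix representation is irreducible. -/
lemma IsIrreducibleRep.of_matrix {k G V W ι : Type*} [Field k] [Group G]
    [AddCommGroup V] [Module k V] [Nontrivial V] [AddCommGroup W] [Module k W] [Fintype ι]
    {σ : Representation k G V} {ρ : Representation k G W} {τ : Representation k G (ι → k)}
    (hρ : IsIrreducibleRep ρ) (e : W ≃ₗ[k] (ι → V)) (A : G → Matrix ι ι k)
    (hA : ∀ g w i, e (ρ g w) i = ∑ j, A g i j • σ g (e w j))
    (hτ : ∀ g u, τ g u = (A g).mulVec u) : IsIrreducibleRep τ := by
  obtain ⟨hW, hρ⟩ := hρ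
  refine ⟨?_, fun U hU => ?_⟩
  · have := e.symm.toEquiv.nontrivial
    by_contra h
    rw [not_nontrivial_iff_subsingleton] at h
    cases isEmpty_or_nonempty ι
    · exact not_subsingleton (ι → V) inferInstance
    · exact not_subsingleton (ι → k) h
  obtain ⟨v, φ₀, hφ₀⟩ : ∃ (v : V) (φ : V →ₗ[k] k), φ v = 1 := by
    obtain ⟨v, hv⟩ := exists_ne (0 : V)
    exact ⟨v, Module.Projective.exists_dual_eq_one k hv⟩
  let S : Submodule k W :=
    ⨅ φ : V →ₗ[k] k, U.comap (φ.compLeft ι ∘ₗ e.toLinearMap)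
  have mem_S {w : W} : w ∈ S ↔ ∀ φ : V →ₗ[k] k, (fun i => φ (e w i)) ∈ U := by
    simp only [S, Submodule.mem_iInf]
    rfl
  have hS : ∀ g, ∀ w ∈ S, ρ g w ∈ S := fun g w hw => mem_S.2 fun φ => by
    have h := hU g _ (mem_S.1 hw (φ ∘ₗ σ g))
    rw [hτ] at h
    convert h using 1
    ext i
    simp [hA, Matrix.mulVec, dotProduct]
  refine (hρ S hS).imp (fun h => ?_) fun h => ?_
  · refine (Submodule.eq_bot_iff _).2 fun u hu => ?_
    have hw : e.symm (fun i => u i • v) ∈ S := mem_S.2 fun φ => by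
      convert U.smul_mem (φ v) hu using 1
      ext i
      simp [mul_comm]
    rw [h, Submodule.mem_bot, e.symm_apply_eq, map_zero] at hw
    ext i
    simpa [hφ₀] using congrArg φ₀ (congrFun hw i)
  · refine eq_top_iff.2 fun u _ => ?_
    have hw : e.symm (fun i => u i • v) ∈ S := h ▸ Submodule.mem_top
    simpa [hφ₀] using mem_S.1 hw φ₀

theorem stmt2 {k : Type*} [Field k] [IsAlgClosed k] {K : Type*} [Group K] [Finite K]
    {V₁ W : Type*} [AddCommGroup V₁] [Module k V₁] [FiniteDimensional k V₁] [Nontrivial V₁]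
    [AddCommGroup W] [Module k W] [FiniteDimensional k W]
    (K₂ : Subgroup K) (hK₂ : K₂.Normal) (hord : ¬ (ringChar k ∣ Nat.card K₂))
    (ρ₁ : Representation k K V₁) (hirr₁ : IsIrreducibleRep ρ₁)
    (hscalar : ∀ f : V₁ →ₗ[k] V₁, (∀ x ∈ K₂, f ∘ₗ ρ₁ x = ρ₁ x ∘ₗ f) →
      ∃ c : k, f = c • LinearMap.id)
    (ρ : Representation k K W) (hirr : IsIrreducibleRep ρ)
    (hres : ∃ (m : ℕ) (e : W ≃ₗ[k] (Fin m → V₁)),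
      ∀ x ∈ K₂, ∀ w : W, e (ρ x w) = fun i => ρ₁ x (e w i)) :
    ∃ (n : ℕ) (ρ₂' : Representation k K (Fin n → k)),
      IsIrreducibleRep ρ₂' ∧ (∀ x ∈ K₂, ρ₂' x = LinearMap.id) ∧
      ∃ e : W ≃ₗ[k] (V₁ ⊗[k] (Fin n → k)),
        ∀ (g : K) (w : W), e (ρ g w) = (ρ₁.tprod ρ₂') g (e w) := by
  obtain ⟨m, e, he⟩ := hres
  choose A hA using Representation.exists_matrix_of_isotypic hK₂ hscalar e he
  have hA_of_mem {x : K} (hx : x ∈ K₂) : A x = 1 := by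
    refine Matrix.ext_of_sum_smul (V := V₁) fun v i => ?_
    have h := hA x (e.symm fun j => ρ₁ x⁻¹ (v j)) i
    rw [he x hx] at h
    simpa [Matrix.one_apply] using h.symm
  have hA_mul (g h : K) : A (g * h) = A g * A h := by
    refine Matrix.ext_of_sum_smul (V := V₁) fun v i => ?_
    have hgh := hA (g * h) (e.symm fun j => ρ₁ (g * h)⁻¹ (v j)) i
    have hcancel (u : V₁) : ρ₁ g (ρ₁ h (ρ₁ (g * h)⁻¹ u)) = u := by
      simp only [← Module.End.mul_apply, ← map_mul]
      simp
    rw [map_mul, Module.End.mul_apply, hA] at hgh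
    simp only [hA, map_sum, map_smul, LinearEquiv.apply_symm_apply, hcancel,
      map_mul, Module.End.mul_apply] at hgh
    rw [← hgh]
    simp only [Matrix.mul_apply, Finset.sum_smul, Finset.smul_sum, mul_smul]
    exact Finset.sum_comm
  let ρ₂ : Representation k K (Fin m → k) :=
    { toFun g := (A g).mulVecLin
      map_one' := by rw [hA_of_mem K₂.one_mem, Matrix.mulVecLin_one]; rfl
      map_mul' g h := by rw [hA_mul, Matrix.mulVecLin_mul]; rfl }
  refine ⟨m, ρ₂, hirr.of_matrix e A hA fun _ _ => rfl, fun x hx => ?_,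
    e ≪≫ₗ (piScalarRight k k V₁ (Fin m)).symm, fun g w => ?_⟩
  · change (A x).mulVecLin = _
    rw [hA_of_mem hx, Matrix.mulVecLin_one]
  · rw [LinearEquiv.trans_apply, LinearEquiv.symm_apply_eq, LinearEquiv.trans_apply]
    obtain ⟨t, ht⟩ := (piScalarRight k k V₁ (Fin m)).surjective (e w)
    ext i
    rw [hA, ← ht, LinearEquiv.symm_apply_apply]
    clear ht
    induction t with
    | zero => simp
    | add s t hs ht => simp only [map_add, Pi.add_apply, smul_add, Finset.sum_add_distrib, hs, ht]
    | tmul v u =>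
      change _ = piScalarRight k k V₁ (Fin m) (ρ₁ g v ⊗ₜ (A g).mulVec u) i
      simp [Matrix.mulVec, dotProduct, Finset.sum_smul, mul_smul]
end

section
/- Let G be a group, J a finite subgroup of G, H a normal subgroup of J, and g ∈ G. Then the number of distinct double cosets of the form HxH with x ∈ JgJ satisfies |{HxH : x ∈ JgJ}| · |H|² · |J ∩ g⁻¹Jg| = |J|² · |H ∩ g⁻¹Hg|. Equivalently, |{HxH : x ∈ JgJ}| = [J:H] · [J : J ∩ g⁻¹Jg] / [H : H ∩ g⁻¹Hg]. -/
/-- A map all of whose fibres are in bijection with a fixed type `F` multiplies cardinalities. -/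
theorem Nat.card_eq_mul_of_fiber_equiv {A B F : Type*} (f : A → B)
    (h : ∀ b, Nonempty ({a // f a = b} ≃ F)) : Nat.card A = Nat.card B * Nat.card F := by
  rw [← Nat.card_prod]
  exact Nat.card_congr ((Equiv.sigmaFiberEquiv f).symm.trans
    ((Equiv.sigmaCongrRight fun b => (h b).some).trans (Equiv.sigmaEquivProd B F)))

namespace DoubleCoset

variable {G : Type*} [Group G]

theorem doubleCoset_eq_setOf (H : Subgroup G) (x : G) :
    {y : G | ∃ a ∈ H, ∃ b ∈ H, y = a * x * b} = doubleCoset x (H : Set G) H := by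
  ext y
  simp [mem_doubleCoset]

theorem doubleCoset_eq_iff {H : Subgroup G} {x y : G} :
    doubleCoset x (H : Set G) H = doubleCoset y H H ↔ x ∈ doubleCoset y (H : Set G) H :=
  ⟨fun h => h ▸ mem_doubleCoset_self H H x, doubleCoset_eq_of_mem⟩

/-- The pairs in `K × K` sent by `(c, d) ↦ c * g * d` into a subset `T` of `K g K` number
`|T|` times the order of `K ∩ g⁻¹ K g`. -/
theorem card_pairs_eq_mul (K : Subgroup G) (g : G) (T : Set G)
    (hT : T ⊆ doubleCoset g (K : Set G) K) :
    Nat.card {p : K × K // (p.1 : G) * g * p.2 ∈ T} =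
      Nat.card T * Nat.card {x : G // x ∈ K ∧ g * x * g⁻¹ ∈ K} := by
  refine Nat.card_eq_mul_of_fiber_equiv (fun p => ⟨_, p.2⟩) ?_
  rintro ⟨y, hy⟩
  obtain ⟨c, hc, d, hd, rfl⟩ := mem_doubleCoset.1 (hT hy)
  refine ⟨⟨fun p => ⟨d * (p.1.1.2 : G)⁻¹, K.mul_mem hd (K.inv_mem p.1.1.2.2), ?_⟩,
    fun x => ⟨⟨(⟨c * (g * x.1 * g⁻¹), K.mul_mem hc x.2.2⟩,
      ⟨x.1⁻¹ * d, K.mul_mem (K.inv_mem x.2.1) hd⟩), ?_⟩, ?_⟩, ?_, ?_⟩⟩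
  · obtain ⟨⟨⟨⟨a, ha⟩, ⟨b, hb⟩⟩, hp⟩, h⟩ := p
    have h' : a * g * b = c * g * d := congrArg Subtype.val h
    have : g * (d * b⁻¹) * g⁻¹ = c⁻¹ * a := by
      calc g * (d * b⁻¹) * g⁻¹ = c⁻¹ * (c * g * d) * b⁻¹ * g⁻¹ := by group
        _ = c⁻¹ * a := by rw [← h']; group
    simpa only [this] using K.mul_mem (K.inv_mem hc) ha
  · have : c * (g * x.1 * g⁻¹) * g * (x.1⁻¹ * d) = c * g * d := by group
    simpa only [this] using hy
  · apply Subtype.ext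
    change c * (g * x.1 * g⁻¹) * g * (x.1⁻¹ * d) = c * g * d
    group
  · rintro ⟨⟨⟨⟨a, ha⟩, ⟨b, hb⟩⟩, hp⟩, h⟩
    have h' : a * g * b = c * g * d := congrArg Subtype.val h
    have : c * (g * (d * b⁻¹) * g⁻¹) = a := by
      calc c * (g * (d * b⁻¹) * g⁻¹) = (c * g * d) * b⁻¹ * g⁻¹ := by group
        _ = a := by rw [← h']; group
    simp [this]
  · rintro ⟨x, hx⟩
    simp

/-- The product of `|H g H|` and the order of `H ∩ g⁻¹ H g` is `|H| ^ 2`. -/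
theorem card_mul_card_inter_conj (H : Subgroup G) (g : G) :
    Nat.card (doubleCoset g (H : Set G) H) * Nat.card {x : G // x ∈ H ∧ g * x * g⁻¹ ∈ H} =
      Nat.card H ^ 2 := by
  rw [← card_pairs_eq_mul H g _ subset_rfl, sq, ← Nat.card_prod]
  exact Nat.card_congr (Equiv.subtypeUnivEquiv fun p =>
    mem_doubleCoset.2 ⟨_, p.1.2, _, p.2.2, rfl⟩)

/-- Elements normalizing `H` can be moved out of an `(H, H)`-double coset. -/
theorem mul_mul_mem_doubleCoset_iff {J H : Subgroup G}
    (hnorm : ∀ j ∈ J, ∀ h ∈ H, j * h * j⁻¹ ∈ H) {a b : G} (ha : a ∈ J) (hb : b ∈ J) (x y : G) :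
    a * x * b ∈ doubleCoset (a * y * b) (H : Set G) H ↔ x ∈ doubleCoset y (H : Set G) H := by
  simp only [mem_doubleCoset, SetLike.mem_coe]
  constructor
  · rintro ⟨h, hh, k, hk, e⟩
    refine ⟨a⁻¹ * h * a, by simpa using hnorm _ (J.inv_mem ha) _ hh,
      b * k * b⁻¹, hnorm _ hb _ hk, ?_⟩
    calc x = a⁻¹ * (a * x * b) * b⁻¹ := by group
      _ = _ := by rw [e]; group
  · rintro ⟨h, hh, k, hk, rfl⟩
    exact ⟨a * h * a⁻¹, hnorm _ ha _ hh, b⁻¹ * k * b,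
      by simpa using hnorm _ (J.inv_mem hb) _ hk, by group⟩

/-- Every `(H, H)`-double coset in `J g J` is hit by the same number of pairs in `J × J`. -/
theorem card_mul_card_pairs {J H : Subgroup G}
    (hnorm : ∀ j ∈ J, ∀ h ∈ H, j * h * j⁻¹ ∈ H) (g : G) :
    Nat.card {S : Set G // ∃ x ∈ doubleCoset g (J : Set G) J, S = doubleCoset x (H : Set G) H} *
      Nat.card {p : J × J // (p.1 : G) * g * p.2 ∈ doubleCoset g (H : Set G) H} =
      Nat.card J ^ 2 := by
  rw [sq, ← Nat.card_prod J J]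
  refine (Nat.card_eq_mul_of_fiber_equiv (fun p : J × J =>
    ⟨_, (p.1 : G) * g * p.2, mem_doubleCoset.2 ⟨_, p.1.2, _, p.2.2, rfl⟩, rfl⟩) ?_).symm
  rintro ⟨S, x, hx, rfl⟩
  obtain ⟨a, ha, b, hb, rfl⟩ := mem_doubleCoset.1 hx
  refine ⟨(((Equiv.mulLeft (⟨a, ha⟩ : J)).prodCongr
    (Equiv.mulRight (⟨b, hb⟩ : J))).subtypeEquiv fun p => ?_).symm⟩
  rw [Subtype.mk.injEq, doubleCoset_eq_iff, ← mul_mul_mem_doubleCoset_iff hnorm ha hb]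
  simp [mul_assoc]

end DoubleCoset

theorem stmt4 {G : Type*} [Group G] (J H : Subgroup G) [Finite ↥J]
    (hHJ : H ≤ J) (hnorm : ∀ j ∈ J, ∀ h ∈ H, j * h * j⁻¹ ∈ H) (g : G) :
    Nat.card {S : Set G // ∃ x ∈ {y : G | ∃ a ∈ J, ∃ b ∈ J, y = a * g * b},
        S = {y : G | ∃ a ∈ H, ∃ b ∈ H, y = a * x * b}} *
      (Nat.card ↥H) ^ 2 * Nat.card {x : G // x ∈ J ∧ g * x * g⁻¹ ∈ J} =
    (Nat.card ↥J) ^ 2 * Nat.card {x : G // x ∈ H ∧ g * x * g⁻¹ ∈ H} := by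
  simp only [DoubleCoset.doubleCoset_eq_setOf]
  have hsub : DoubleCoset.doubleCoset g (H : Set G) H ⊆ DoubleCoset.doubleCoset g (J : Set G) J :=
    Set.mul_subset_mul (Set.mul_subset_mul_right hHJ) hHJ
  rw [← DoubleCoset.card_mul_card_pairs hnorm g, DoubleCoset.card_pairs_eq_mul J g _ hsub,
    ← DoubleCoset.card_mul_card_inter_conj H g]
  ring
end

section
/- Let G be a group, p an odd prime, J a finite p-group contained in G, H a normal subgroup of J, and g ∈ G. Then the number of distinct double cosets of the form HxH with x ∈ JgJ is odd. -/
/-- The action of `J × J` on the subsets of `G` given by `(a, b) • S = a S b⁻¹`. -/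
abbrev twoSidedSetAction {G : Type*} [Group G] (J : Subgroup G) : MulAction (J × J) (Set G) where
  smul q S := (fun x : G => (q.1 : G) * x * (q.2 : G)⁻¹) '' S
  one_smul S := by
    change (fun x : G => ((1 : J) : G) * x * ((1 : J) : G)⁻¹) '' S = S
    simp
  mul_smul q r S := by
    change (fun x : G => ((q.1 * r.1 : J) : G) * x * ((q.2 * r.2 : J) : G)⁻¹) '' S =
      (fun x : G => (q.1 : G) * x * (q.2 : G)⁻¹) ''
        ((fun x : G => (r.1 : G) * x * (r.2 : G)⁻¹) '' S)
    rw [Set.image_image]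
    simp [mul_assoc]

/-- If `a` and `b` normalize `H`, then `a (H x H) b⁻¹ = H (a x b⁻¹) H`. -/
theorem image_doubleCoset_of_normalized {G : Type*} [Group G] {J H : Subgroup G}
    (hnorm : ∀ j ∈ J, ∀ h ∈ H, j * h * j⁻¹ ∈ H) {a b : G} (ha : a ∈ J) (hb : b ∈ J) (x : G) :
    (fun y : G => a * y * b⁻¹) '' {y : G | ∃ c ∈ H, ∃ d ∈ H, y = c * x * d} =
      {y : G | ∃ c ∈ H, ∃ d ∈ H, y = c * (a * x * b⁻¹) * d} := by
  ext y
  constructor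
  · rintro ⟨_, ⟨c, hc, d, hd, rfl⟩, rfl⟩
    exact ⟨a * c * a⁻¹, hnorm a ha c hc, b * d * b⁻¹, hnorm b hb d hd, by group⟩
  · rintro ⟨c, hc, d, hd, rfl⟩
    refine ⟨_, ⟨a⁻¹ * c * a, ?_, b⁻¹ * d * b, ?_, rfl⟩, by group⟩
    · simpa using hnorm a⁻¹ (J.inv_mem ha) c hc
    · simpa using hnorm b⁻¹ (J.inv_mem hb) d hd

theorem stmt5 {G : Type*} [Group G] (p : ℕ) (hp : p.Prime) (hodd : Odd p)
    (J H : Subgroup G) [Finite ↥J] (hcard : ∃ n : ℕ, Nat.card ↥J = p ^ n)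
    (hHJ : H ≤ J) (hnorm : ∀ j ∈ J, ∀ h ∈ H, j * h * j⁻¹ ∈ H) (g : G) :
    Odd (Nat.card {S : Set G // ∃ x ∈ {y : G | ∃ a ∈ J, ∃ b ∈ J, y = a * g * b},
        S = {y : G | ∃ a ∈ H, ∃ b ∈ H, y = a * x * b}}) := by
  have : Fact p.Prime := ⟨hp⟩
  obtain ⟨n, hn⟩ := hcard
  have hJJ : IsPGroup p (J × J) := IsPGroup.of_card (n := n + n) (by
    rw [Nat.card_prod, hn, pow_add])
  let _ := twoSidedSetAction J
  let D : Set G := {y : G | ∃ a ∈ H, ∃ b ∈ H, y = a * g * b}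
  have hfin : Finite (MulAction.orbit (J × J) D) := Set.finite_range _
  obtain ⟨k, hk⟩ := hJJ.card_orbit D
  have horbit : {S : Set G | ∃ x ∈ {y : G | ∃ a ∈ J, ∃ b ∈ J, y = a * g * b},
      S = {y : G | ∃ a ∈ H, ∃ b ∈ H, y = a * x * b}} = MulAction.orbit (J × J) D := by
    ext S
    constructor
    · rintro ⟨_, ⟨a, ha, b, hb, rfl⟩, rfl⟩
      refine ⟨(⟨a, ha⟩, ⟨b⁻¹, J.inv_mem hb⟩), ?_⟩
      refine (image_doubleCoset_of_normalized hnorm ha (J.inv_mem hb) g).trans ?_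
      rw [inv_inv]
    · rintro ⟨⟨a, b⟩, rfl⟩
      exact ⟨a * g * (b : G)⁻¹, ⟨a, a.2, (b : G)⁻¹, J.inv_mem b.2, rfl⟩,
        image_doubleCoset_of_normalized hnorm a.2 b.2 g⟩
  rw [← horbit] at hk
  exact hk ▸ hodd.pow
end

section
/- Let G be a group and τ : G → G a group automorphism with τ ∘ τ = id. Let U₋, M, U₊ be subgroups of G, each mapped into itself by τ, and assume uniqueness of Iwahori factorizations: whenever u₋ m u₊ = u₋′ m′ u₊′ with u₋, u₋′ ∈ U₋, m, m′ ∈ M, u₊, u₊′ ∈ U₊, then u₋ = u₋′, m = m′ and u₊ = u₊′. Let K be a subgroup of G with τ(K) ⊆ K such that every element of K can be written as a product u₋ m u₊ with u₋ ∈ K ∩ U₋, m ∈ K ∩ M, u₊ ∈ K ∩ U₊. Then every element h ∈ K with τ(h) = h can be written as h = u₋ m u₊ with u₋ ∈ K ∩ U₋, m ∈ K ∩ M, u₊ ∈ K ∩ U₊ and τ(u₋) = u₋, τ(m) = m, τ(u₊) = u₊. -/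
theorem stmt6 {G : Type*} [Group G] (τ : G →* G) (hτ : ∀ g, τ (τ g) = g)
    (Um M Up : Subgroup G)
    (hUm : ∀ u ∈ Um, τ u ∈ Um) (hM : ∀ m ∈ M, τ m ∈ M) (hUp : ∀ u ∈ Up, τ u ∈ Up)
    (huniq : ∀ u₁ ∈ Um, ∀ m₁ ∈ M, ∀ w₁ ∈ Up, ∀ u₂ ∈ Um, ∀ m₂ ∈ M, ∀ w₂ ∈ Up,
      u₁ * m₁ * w₁ = u₂ * m₂ * w₂ → u₁ = u₂ ∧ m₁ = m₂ ∧ w₁ = w₂)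
    (K : Subgroup G) (hK : ∀ x ∈ K, τ x ∈ K)
    (hdecomp : ∀ x ∈ K, ∃ u ∈ K ⊓ Um, ∃ m ∈ K ⊓ M, ∃ w ∈ K ⊓ Up, x = u * m * w)
    (h : G) (hhK : h ∈ K) (hfix : τ h = h) :
    ∃ u ∈ K ⊓ Um, ∃ m ∈ K ⊓ M, ∃ w ∈ K ⊓ Up,
      h = u * m * w ∧ τ u = u ∧ τ m = m ∧ τ w = w := by
  obtain ⟨u, hu, m, hm, w, hw, rfl⟩ := hdecomp h hhK
  refine ⟨u, hu, m, hm, w, hw, rfl, ?_⟩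
  exact huniq _ (hUm u hu.2) _ (hM m hm.2) _ (hUp w hw.2) u hu.2 m hm.2 w hw.2
    (by simpa only [map_mul] using hfix)
end

section
/- Let F be a field of characteristic different from 2, V an F-vector space, and B : V × V → F an F-bilinear form that is alternating (B(v,v) = 0 for all v) and nondegenerate (if B(v,w) = 0 for all w ∈ V then v = 0). Let τ : V → V be an F-linear map with τ ∘ τ = id, and suppose that B(x, y) = B(x, τ(y)) for every x ∈ V with τ(x) = x and every y ∈ V. Then the restriction of B to the fixed subspace V^τ = {v ∈ V : τ(v) = v} is nondegenerate: if x ∈ V^τ and B(x, z) = 0 for all z ∈ V^τ, then x = 0. -/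
theorem stmt8 {F V : Type*} [Field F] (h2 : (2 : F) ≠ 0)
    [AddCommGroup V] [Module F V]
    (B : V →ₗ[F] V →ₗ[F] F)
    (halt : ∀ v : V, B v v = 0)
    (hnd : ∀ v : V, (∀ w : V, B v w = 0) → v = 0)
    (τ : V →ₗ[F] V) (hτ : ∀ v : V, τ (τ v) = v)
    (hB : ∀ x : V, τ x = x → ∀ y : V, B x y = B x (τ y)) :
    ∀ x : V, τ x = x → (∀ z : V, τ z = z → B x z = 0) → x = 0 := by
  intro x hx hxz
  refine hnd x fun y => ?_
  have h : B x (y + τ y) = 0 := hxz _ (by rw [map_add, hτ, add_comm])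
  rw [map_add, ← hB x hx y, ← two_mul] at h
  exact (mul_eq_zero.mp h).resolve_left h2
end

section
/- Let k be a field, J a finite group whose order is not divisible by the characteristic of k, H a normal subgroup of J such that J/H is abelian (i.e. aba⁻¹b⁻¹ ∈ H for all a, b ∈ J), and K a subgroup with H ≤ K ≤ J. Let θ : H → kˣ be a group homomorphism, and let ρ be an irreducible representation of J on a nonzero finite-dimensional k-vector space W such that every irreducible representation ρ′ of J containing θ (i.e. admitting a nonzero vector v with ρ′(h)v = θ(h)·v for all h ∈ H) is isomorphic to ρ. Then J acts transitively on the set of homomorphisms K → kˣ extending θ: for any two homomorphisms ξ, ξ′ : K → kˣ with ξ|_H = ξ′|_H = θ there exists j ∈ J such that ξ′(x) = ξ(j⁻¹ x j) for all x ∈ K. -/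
/-- A representation contains the character `θ` of the subgroup `H` if there is a
nonzero vector on which every `h ∈ H` acts by the scalar `θ h`. -/
def ContainsChar {k : Type*} [Field k] {J : Type*} [Group J] (H : Subgroup J)
    (θ : H →* kˣ) {W : Type*} [AddCommGroup W] [Module k W]
    (ρ : Representation k J W) : Prop :=
  ∃ v : W, v ≠ 0 ∧ ∀ h : H, ρ ↑h v = θ h • v

namespace Representation

variable {k G V V₂ : Type*} [Field k] [Group G] [AddCommGroup V] [Module k V]
  [AddCommGroup V₂] [Module k V₂]

/-- Transport of a representation along a linear equivalence. -/
def transport (σ : Representation k G V) (e : V ≃ₗ[k] V₂) : Representation k G V₂ where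
  toFun g := e.toLinearMap ∘ₗ σ g ∘ₗ e.symm.toLinearMap
  map_one' := by ext; simp
  map_mul' a b := by ext; simp

@[simp]
theorem transport_apply (σ : Representation k G V) (e : V ≃ₗ[k] V₂) (g : G) (v : V₂) :
    σ.transport e g v = e (σ g (e.symm v)) := rfl

/-- The restriction of a representation to a stable submodule. -/
def restrictStable (σ : Representation k G V) (U : Submodule k V)
    (hU : ∀ g : G, ∀ v ∈ U, σ g v ∈ U) : Representation k G U where
  toFun g := (σ g).restrict (hU g)
  map_one' := by ext; simp
  map_mul' a b := by ext; simp

@[simp]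
theorem coe_restrictStable_apply (σ : Representation k G V) (U : Submodule k V)
    (hU : ∀ g : G, ∀ v ∈ U, σ g v ∈ U) (g : G) (v : U) :
    (σ.restrictStable U hU g v : V) = σ g v := rfl

/-- The action of a group on its `k`-valued functions by right translation. -/
def rightTranslation (k G : Type*) [Field k] [Group G] : Representation k G (G → k) where
  toFun g := LinearMap.funLeft k k (· * g)
  map_one' := by ext; simp [LinearMap.funLeft]
  map_mul' a b := by ext; simp [LinearMap.funLeft, mul_assoc]

@[simp]
theorem rightTranslation_apply (g : G) (f : G → k) (x : G) :
    rightTranslation k G g f x = f (x * g) := rfl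

/-- The (unnormalized) projector onto the `ξ`-isotypic vectors for a character `ξ` of `K`. -/
noncomputable def charSum (σ : Representation k G V) (K : Subgroup G) [Fintype K]
    (ξ : K →* kˣ) : V →ₗ[k] V :=
  ∑ x : K, ((ξ x)⁻¹ : kˣ) • σ x

variable (σ : Representation k G V) {K : Subgroup G} [Fintype K] (ξ : K →* kˣ)

theorem charSum_apply (v : V) : σ.charSum K ξ v = ∑ x : K, (ξ x)⁻¹ • σ x v := by
  simp [charSum]

theorem apply_charSum (y : K) (v : V) : σ y (σ.charSum K ξ v) = ξ y • σ.charSum K ξ v := by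
  simp only [charSum_apply, map_sum, Finset.smul_sum]
  refine Fintype.sum_equiv (Equiv.mulLeft y) _ _ fun x => ?_
  simp [Units.smul_def, smul_smul, mul_comm]

theorem charSum_of_forall_apply_eq {v : V} (hv : ∀ x : K, σ x v = ξ x • v) :
    σ.charSum K ξ v = (Nat.card K : k) • v := by
  simp [charSum_apply, hv, Nat.cast_smul_eq_nsmul]

theorem charSum_mem {U : Submodule k V} (hU : ∀ g : G, ∀ v ∈ U, σ g v ∈ U) {v : V}
    (hv : v ∈ U) : σ.charSum K ξ v ∈ U := by
  rw [charSum_apply]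
  exact U.sum_mem fun x _ => U.smul_mem _ (hU x v hv)

end Representation

theorem Subgroup.natCast_card_ne_zero {k J : Type*} [Field k] [Group J]
    (hord : ¬ (ringChar k ∣ Nat.card J)) (K : Subgroup J) : (Nat.card K : k) ≠ 0 := fun h =>
  hord (((ringChar.spec k _).1 h).trans K.card_subgroup_dvd_card)

theorem IsIrreducibleRep.transport {k G V V₂ : Type*} [Field k] [Group G] [AddCommGroup V]
    [Module k V] [AddCommGroup V₂] [Module k V₂] {σ : Representation k G V}
    (hσ : IsIrreducibleRep σ) (e : V ≃ₗ[k] V₂) : IsIrreducibleRep (σ.transport e) := by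
  obtain ⟨_, h⟩ := hσ
  refine ⟨e.symm.toEquiv.nontrivial, fun U hU => ?_⟩
  have key := h (U.comap e.toLinearMap) fun g v hv => by simpa using hU g (e v) hv
  have hmap : (U.comap e.toLinearMap).map e.toLinearMap = U :=
    Submodule.map_comap_eq_of_surjective e.surjective U
  rcases key with key | key
  · left; rw [← hmap, key, Submodule.map_bot]
  · right; rw [← hmap, key, Submodule.map_top, LinearMap.range_eq_top.2 e.surjective]

namespace ContainsChar

variable {k J V V₂ : Type*} [Field k] [Group J] [AddCommGroup V] [Module k V]
  [AddCommGroup V₂] [Module k V₂] {H K : Subgroup J} {ξ : K →* kˣ}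
  {σ : Representation k J V}

theorem of_equivariant {σ' : Representation k J V₂} (h : ContainsChar K ξ σ) (e : V ≃ₗ[k] V₂)
    (he : ∀ (g : J) (v : V), e (σ g v) = σ' g (e v)) : ContainsChar K ξ σ' := by
  obtain ⟨v, hv0, hv⟩ := h
  refine ⟨e v, by simpa using hv0, fun x => ?_⟩
  rw [← he, hv, Units.smul_def, Units.smul_def, map_smul]

theorem restrict (h : ContainsChar K ξ σ) (hHK : H ≤ K) {θ : H →* kˣ}
    (hξ : ∀ (x : J) (hx : x ∈ H), ξ ⟨x, hHK hx⟩ = θ ⟨x, hx⟩) : ContainsChar H θ σ := by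
  obtain ⟨v, hv0, hv⟩ := h
  exact ⟨v, hv0, fun x => by simpa [hξ x.1 x.2] using hv ⟨x, hHK x.2⟩⟩

end ContainsChar

section Coinduced

variable {k J : Type*} [Field k] [Group J] {K : Subgroup J}

/-- The functions on `J` which transform on the left under `K` by the character `ξ`. -/
def coinducedChar (ξ : K →* kˣ) : Submodule k (J → k) where
  carrier := {f | ∀ (x : K) (g : J), f (x * g) = ξ x * f g}
  add_mem' hf hf' x g := by simp [hf x g, hf' x g, mul_add]
  zero_mem' x g := by simp
  smul_mem' c f hf x g := by simp [hf x g, mul_left_comm]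

theorem coinducedChar_stable (ξ : K →* kˣ) (g : J) (f : J → k) (hf : f ∈ coinducedChar ξ) :
    Representation.rightTranslation k J g f ∈ coinducedChar ξ := fun x y => by
  simpa [mul_assoc] using hf x (y * g)

theorem coinducedChar_ne_bot (ξ : K →* kˣ) : coinducedChar ξ ≠ ⊥ := by
  classical
  refine (Submodule.ne_bot_iff _).2
    ⟨fun g => if h : g ∈ K then (ξ ⟨g, h⟩ : k) else 0, fun x g => ?_, fun h => ?_⟩
  · by_cases hg : g ∈ K
    · have : (⟨x * g, K.mul_mem x.2 hg⟩ : K) = x * ⟨g, hg⟩ := rfl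
      simp [hg, K.mul_mem x.2 hg, this]
    · simp [hg, K.mul_mem_cancel_left x.2]
  · simpa [K.one_mem] using congrFun h 1

theorem exists_char_vector_of_le_coinducedChar [Finite J] (hK : (Nat.card K : k) ≠ 0)
    (ξ : K →* kˣ) {U : Submodule k (J → k)} (hU0 : U ≠ ⊥) (hle : U ≤ coinducedChar ξ)
    (hU : ∀ g : J, ∀ f ∈ U, Representation.rightTranslation k J g f ∈ U) :
    ∃ f ∈ U, f ≠ 0 ∧ ∀ x : K, Representation.rightTranslation k J x f = ξ x • f := by
  have := Fintype.ofFinite K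
  obtain ⟨f, hfU, hf0⟩ := (Submodule.ne_bot_iff _).1 hU0
  obtain ⟨g, hg⟩ := Function.ne_iff.1 hf0
  set f₁ := Representation.rightTranslation k J g f with hf₁
  have hf₁U : f₁ ∈ U := hU g f hfU
  refine ⟨(Representation.rightTranslation k J).charSum K ξ f₁,
    Representation.charSum_mem _ ξ hU hf₁U, fun h => ?_,
    fun x => Representation.apply_charSum _ ξ x f₁⟩
  have hval : (Representation.rightTranslation k J).charSum K ξ f₁ 1 = Nat.card K * f g := by
    have hx (x : K) : f₁ x = ξ x * f g := by simpa [hf₁] using hle hfU x g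
    simp [Representation.charSum_apply, Units.smul_def, hx]
  rw [h] at hval
  exact mul_ne_zero hK hg hval.symm

theorem exists_irreducible_containsChar [Finite J] (hK : (Nat.card K : k) ≠ 0) (ξ : K →* kˣ) :
    ∃ (U : Submodule k (J → k)) (σ : Representation k J U),
      IsIrreducibleRep σ ∧ ContainsChar K ξ σ := by
  obtain ⟨U, ⟨hU0, hle, hU⟩, hmin⟩ := (wellFounded_lt (α := Submodule k (J → k))).has_min
    {U | U ≠ ⊥ ∧ U ≤ coinducedChar ξ ∧
      ∀ g : J, ∀ f ∈ U, Representation.rightTranslation k J g f ∈ U}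
    ⟨_, coinducedChar_ne_bot ξ, le_rfl, coinducedChar_stable ξ⟩
  refine ⟨U, (Representation.rightTranslation k J).restrictStable U hU,
    ⟨Submodule.nontrivial_iff_ne_bot.2 hU0, fun X hX => ?_⟩, ?_⟩
  · by_contra! hne
    refine hmin (X.map U.subtype)
      ⟨fun h => hne.1 (Submodule.map_injective_of_injective U.injective_subtype (by simpa using h)),
        (U.map_subtype_le X).trans hle, ?_⟩
      (lt_of_le_of_ne (U.map_subtype_le X) fun h => hne.2 ?_)
    · rintro g _ ⟨f, hf, rfl⟩
      exact ⟨_, hX g f hf, rfl⟩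
    · refine Submodule.map_injective_of_injective U.injective_subtype ?_
      rw [h, Submodule.map_subtype_top]
  · obtain ⟨f, hfU, hf0, hf⟩ := exists_char_vector_of_le_coinducedChar hK ξ hU0 hle hU
    exact ⟨⟨f, hfU⟩, by simpa using hf0, fun x => Subtype.ext (hf x)⟩

end Coinduced

theorem IsIrreducibleRep.span_orbit_eq_top {k G V : Type*} [Field k] [Group G] [AddCommGroup V]
    [Module k V] {σ : Representation k G V} (hσ : IsIrreducibleRep σ) {v : V} (hv : v ≠ 0) :
    Submodule.span k (Set.range fun g => σ g v) = ⊤ := by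
  refine (hσ.2 _ fun g w hw => ?_).resolve_left fun h => hv ?_
  · refine (Submodule.span_le (p := (Submodule.span k (Set.range fun g => σ g v)).comap (σ g))).2
      ?_ hw
    rintro _ ⟨a, rfl⟩
    exact Submodule.subset_span ⟨g * a, by simp⟩
  · exact (Submodule.mem_bot k).1 (h ▸ Submodule.subset_span ⟨1, by simp⟩)

theorem IsIrreducibleRep.exists_conj_of_containsChar {k J V : Type*} [Field k] [Group J] [Finite J]
    [AddCommGroup V] [Module k V] {σ : Representation k J V} (hσ : IsIrreducibleRep σ)
    {K : Subgroup J} (hK : (Nat.card K : k) ≠ 0)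
    (hconj : ∀ j : J, ∀ x ∈ K, j⁻¹ * x * j ∈ K) {ξ ξ' : K →* kˣ}
    (h : ContainsChar K ξ σ) (h' : ContainsChar K ξ' σ) :
    ∃ j : J, ∀ (x : J) (hx : x ∈ K), ξ' ⟨x, hx⟩ = ξ ⟨j⁻¹ * x * j, hconj j x hx⟩ := by
  have := Fintype.ofFinite K
  obtain ⟨v, hv0, hv⟩ := h
  obtain ⟨w, hw0, hw⟩ := h'
  have hne : σ.charSum K ξ' ≠ 0 := fun h0 => by
    have := σ.charSum_of_forall_apply_eq ξ' hw
    rw [h0, LinearMap.zero_apply] at this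
    exact smul_ne_zero hK hw0 this.symm
  obtain ⟨j, hj⟩ : ∃ j, σ.charSum K ξ' (σ j v) ≠ 0 := by
    by_contra! hall
    refine hne (LinearMap.ext_on_range (hσ.span_orbit_eq_top hv0) fun j => ?_)
    simpa using hall j
  have hact (x : K) : σ x (σ j v) = ξ ⟨j⁻¹ * x * j, hconj j x x.2⟩ • σ j v := by
    have := hv ⟨j⁻¹ * x * j, hconj j x x.2⟩
    calc σ x (σ j v) = σ j (σ (j⁻¹ * x * j) v) := by
          simp only [← Module.End.mul_apply, ← map_mul]; group
      _ = _ := by rw [this, Units.smul_def, Units.smul_def, map_smul]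
  obtain ⟨c, hc⟩ : ∃ c : k, σ.charSum K ξ' (σ j v) = c • σ j v := by
    refine ⟨∑ x : K, ((ξ' x)⁻¹ : kˣ) * (ξ ⟨j⁻¹ * x * j, hconj j x x.2⟩ : k), ?_⟩
    simp only [σ.charSum_apply, hact, Finset.sum_smul, Units.smul_def, smul_smul]
  refine ⟨j, fun x hx => Units.ext (smul_left_injective k hj ?_)⟩
  have h₁ := σ.apply_charSum ξ' ⟨x, hx⟩ (σ j v)
  have h₂ := hact ⟨x, hx⟩
  simp only [Units.smul_def] at h₁ h₂
  rw [hc, map_smul, h₂, smul_comm, ← hc] at h₁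
  exact h₁.symm

theorem stmt11 {k : Type u_1} [Field k] {J : Type u_2} [Group J] [Finite J]
    (hord : ¬ (ringChar k ∣ Nat.card J))
    (H K : Subgroup J) (hHnorm : H.Normal) (hHK : H ≤ K)
    (habel : ∀ a b : J, a * b * a⁻¹ * b⁻¹ ∈ H)
    (θ : H →* kˣ)
    {W : Type u_3} [AddCommGroup W] [Module k W] [FiniteDimensional k W] [Nontrivial W]
    (ρ : Representation k J W) (hirr : IsIrreducibleRep ρ)
    (huniq : ∀ (W' : Type u_3) [AddCommGroup W'] [Module k W']
      (ρ' : Representation k J W'), IsIrreducibleRep ρ' → ContainsChar H θ ρ' →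
      ∃ e : W' ≃ₗ[k] W, ∀ (g : J) (w : W'), e (ρ' g w) = ρ g (e w))
    (ξ ξ' : K →* kˣ)
    (hξ : ∀ (x : J) (hx : x ∈ H), ξ ⟨x, hHK hx⟩ = θ ⟨x, hx⟩)
    (hξ' : ∀ (x : J) (hx : x ∈ H), ξ' ⟨x, hHK hx⟩ = θ ⟨x, hx⟩) :
    ∃ j : J, ∃ hconj : ∀ x ∈ K, j⁻¹ * x * j ∈ K,
      ∀ (x : J) (hx : x ∈ K), ξ' ⟨x, hx⟩ = ξ ⟨j⁻¹ * x * j, hconj x hx⟩ := by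
  have hK : (Nat.card K : k) ≠ 0 := K.natCast_card_ne_zero hord
  have hconj (j x : J) (hx : x ∈ K) : j⁻¹ * x * j ∈ K := by
    simpa using K.mul_mem (hHK (habel j⁻¹ x)) hx
  have hcontains (χ : K →* kˣ) (hχ : ∀ (x : J) (hx : x ∈ H), χ ⟨x, hHK hx⟩ = θ ⟨x, hx⟩) :
      ContainsChar K χ ρ := by
    obtain ⟨U, σ, hσ, hσχ⟩ := exists_irreducible_containsChar hK χ
    obtain ⟨w, hw⟩ := exists_ne (0 : W)
    have : Small.{u_3} k := small_of_injective (smul_left_injective k hw)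
    have : Small.{u_3} U := small_of_injective
      (((Finite.equivFin J).arrowCongr (equivShrink.{u_3} k)).injective.comp U.injective_subtype)
    let s : U ≃ₗ[k] Shrink.{u_3} U := (Shrink.linearEquiv k U).symm
    have hτχ : ContainsChar K χ (σ.transport s) := hσχ.of_equivariant s fun g v => by simp
    obtain ⟨e, he⟩ := huniq _ _ (hσ.transport s) (hτχ.restrict hHK hχ)
    exact hτχ.of_equivariant e he
  obtain ⟨j, hj⟩ := hirr.exists_conj_of_containsChar hK hconj (hcontains ξ hξ) (hcontains ξ' hξ')
  exact ⟨j, hconj j, hj⟩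
end
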